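/- An arbitrary finite word of integers is an involution word for some element of I_ℤ if and only if its ≡-equivalence class contains no word with two equal adjacent letters. -/

import Mathlib

/-! ## Primed letters: the alphabet `ℤ ⊔ ℤ'`, with `i' = i - 1/2`.
A letter is encoded by its "ceiling" together with a flag recording whether it is primed. -/

structure Letter where
  ceil : ℤ
  primed : Bool
deriving DecidableEq, Repr

instance : Inhabited Letter := ⟨⟨0, false⟩⟩

/-- The order `⋯ < 1' < 1 < 2' < 2 < ⋯`. -/
instance : LinearOrder Letter :=
  LinearOrder.lift' (fun x : Letter => toLex (x.ceil, !x.primed))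
    (fun a b h => by
      have h' : (a.ceil, !a.primed) = (b.ceil, !b.primed) := toLex.injective h
      obtain ⟨ac, ap⟩ := a
      obtain ⟨bc, bp⟩ := b
      simp only [Prod.mk.injEq] at h'
      obtain ⟨h1, h2⟩ := h'
      cases ap <;> cases bp <;> simp_all)

/-- A primed word. -/
abbrev PWord := List Letter

def Letter.unprime (x : Letter) : Letter := ⟨x.ceil, false⟩

def Letter.succL (x : Letter) : Letter := ⟨x.ceil + 1, x.primed⟩

/-- `unprime` of a primed word: replace each letter `x` by `⌈x⌉`. -/
def unprimeWord (a : PWord) : List ℤ := a.map Letter.ceil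

/-- `unprime` of a primed word, as a primed word with no primes. -/
def unprimeP (a : PWord) : PWord := a.map Letter.unprime

/-! ## Involution words -/

/-- The simple transposition `s_i = (i, i+1)` of `ℤ`. -/
def sPerm (i : ℤ) : Equiv.Perm ℤ := Equiv.swap i (i + 1)

/-- The Demazure product `s_{w_1} ∘ s_{w_2} ∘ ⋯ ∘ s_{w_k}` of a word, computed by the
defining recursion `σ ∘ s_i = σ·s_i` if `σ(i) < σ(i+1)` and `σ ∘ s_i = σ` otherwise. -/
def heckeProd (w : List ℤ) : Equiv.Perm ℤ :=
  w.foldl (fun σ i => if σ i < σ (i + 1) then σ * sPerm i else σ) 1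

/-- `s_{a_n} ∘ ⋯ ∘ s_{a_2} ∘ s_{a_1} ∘ s_{a_2} ∘ ⋯ ∘ s_{a_n}` for `a = a_1 a_2 ⋯ a_n`. -/
def invHecke (a : List ℤ) : Equiv.Perm ℤ := heckeProd (a.reverse ++ a.tail)

/-- Membership in `I_ℤ`: a finitely supported involution of `ℤ`. -/
def IZ (z : Equiv.Perm ℤ) : Prop := {x : ℤ | z x ≠ x}.Finite ∧ z * z = 1

/-- The set of involution words of `z`. -/
def Rinv (z : Equiv.Perm ℤ) : Set (List ℤ) :=
  {a | invHecke a = z ∧ ∀ b : List ℤ, invHecke b = z → a.length ≤ b.length}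

/-- 0-based index `k` is a commutation in the word `a` (this corresponds to the 1-based
index `k+1`): `a_{k+1}` and `a_{k+1} + 1` are both fixed points of
`s_{a_k} ∘ ⋯ ∘ s_{a_1} ∘ ⋯ ∘ s_{a_k}`. -/
def IsCommutation (a : List ℤ) (k : ℕ) : Prop :=
  ∃ x, a[k]? = some x ∧ invHecke (a.take k) x = x ∧ invHecke (a.take k) (x + 1) = x + 1

/-- The set of primed involution words of `z`. -/
def RinvPlus (z : Equiv.Perm ℤ) : Set PWord :=
  {a | unprimeWord a ∈ Rinv z ∧
     ∀ (k : ℕ) (x : Letter), a[k]? = some x → x.primed = true →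
       IsCommutation (unprimeWord a) k}

/-! ## Shifted tableaux.
A shifted tableau is recorded as its list of rows, from the first (bottom) row upward;
the entry at 0-based index `k` of 0-based row `r` occupies the box in row `r+1` and
column `r+1+k` of the shifted diagram. -/

abbrev STab := List (List Letter)

/-- A strict partition, recorded as its (strictly decreasing) list of positive parts. -/
def IsStrictPartition (sh : List ℕ) : Prop :=
  List.Chain' (fun a b => b < a) sh ∧ ∀ m ∈ sh, 0 < m

def shapeOf {α : Type*} (T : List (List α)) : List ℕ := T.map List.length

/-- The rows form the shifted diagram of a strict partition. -/
def IsShifted {α : Type*} (T : List (List α)) : Prop := IsStrictPartition (shapeOf T)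

/-- The entry of `T` in (0-based) row `r` and column `c` of the shifted diagram. -/
def entryG? {α : Type*} (T : List (List α)) (r c : ℕ) : Option α :=
  if r ≤ c then (T[r]?).bind (fun row => row[c - r]?) else none

def entry? (T : STab) (r c : ℕ) : Option Letter := entryG? T r c

def setRowG {α : Type*} (T : List (List α)) (r : ℕ) (row : List α) : List (List α) :=
  if r < T.length then T.set r row else T ++ [row]

def setEntryG {α : Type*} (T : List (List α)) (r c : ℕ) (x : α) : List (List α) :=
  T.set r ((T.getD r []).set (c - r) x)

def numCols {α : Type*} (T : List (List α)) : ℕ := (T.getD 0 []).length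

/-- Row reading word: rows left to right, starting with the last (top) row. -/
def rowWord (T : STab) : PWord := T.reverse.flatten

/-- Column reading word: columns top to bottom, starting with the first column. -/
def colWord (T : STab) : PWord :=
  (List.range (numCols T)).flatMap (fun c =>
    ((List.range (c + 1)).reverse).filterMap (fun r => entry? T r c))

def unprimeT (T : STab) : STab := T.map (List.map Letter.unprime)

/-- Remove the primes from all main-diagonal entries. -/
def unprimeDiagT (T : STab) : STab :=
  T.map (fun row =>
    match row with
    | [] => []
    | x :: rest => Letter.unprime x :: rest)

/-- Rows and columns are strictly increasing. -/
def IsIncreasing (T : STab) : Prop :=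
  (∀ r c x y, entry? T r c = some x → entry? T r (c + 1) = some y → x < y) ∧
  (∀ r c x y, entry? T r c = some x → entry? T (r + 1) c = some y → x < y)

/-- No primed entries on the main diagonal. -/
def NoDiagPrimes (T : STab) : Prop :=
  ∀ r x, entry? T r r = some x → x.primed = false

/-- Entries positive, rows and columns weakly increasing, no primed entry repeated
in a row and no unprimed entry repeated in a column. -/
def IsSemistandard (T : STab) : Prop :=
  (∀ x ∈ T.flatten, 0 < x.ceil) ∧
  (∀ r c x y, entry? T r c = some x → entry? T r (c + 1) = some y → x ≤ y) ∧
  (∀ r c x y, entry? T r c = some x → entry? T (r + 1) c = some y → x ≤ y) ∧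
  (∀ r c c' x, c < c' → entry? T r c = some x → entry? T r c' = some x →
    x.primed = false) ∧
  (∀ r r' c x, r < r' → entry? T r c = some x → entry? T r' c = some x →
    x.primed = true)

/-- Increasing, with exactly one of `i` or `i'` as an entry for each `i = 1, …, n`,
where `n` is the number of boxes. -/
def IsStandard (T : STab) : Prop :=
  IsIncreasing T ∧
  ∀ i : ℤ, 1 ≤ i → i ≤ (T.flatten.length : ℤ) →
    T.flatten.countP (fun x => decide (x.ceil = i)) = 1
/-! ## Orthogonal Edelman–Greene insertion -/

/-- "Switching the primes" of a pair: reverse the primes on both letters if exactly one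
of them is unprimed, and leave them unchanged otherwise. -/
def switchPrimes (x y : Letter) : Letter × Letter :=
  if x.primed = y.primed then (x, y)
  else (⟨x.ceil, !x.primed⟩, ⟨y.ceil, !y.primed⟩)

/-- Column-insertion stage of orthogonal Edelman–Greene insertion:
insert letter `w` into column `c` of `T` (then continue into later columns). -/
def egCol : ℕ → STab → ℕ → Letter → STab × Bool
  | 0, T, _, _ => (T, true)
  | fuel + 1, T, c, w =>
    let occ := (List.range (c + 1)).filterMap (fun r => (entry? T r c).map (fun x => (r, x)))
    match occ.findIdx? (fun p => decide (w.ceil < p.2.ceil)) with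
    | none =>
        -- place `w` in the first empty box of the column
        let r := occ.length
        let w' := if r = c ∧ w.primed then Letter.unprime w else w
        (setRowG T r ((T.getD r []) ++ [w']), if r = c then w.primed else true)
    | some kM =>
        let km := (occ.findIdx? (fun p => decide (w.ceil ≤ p.2.ceil))).getD kM
        let im := (occ.getD km (0, default)).1
        let m := (occ.getD km (0, default)).2
        if km = kM then
          if im = c then
            -- m = M on the main diagonal
            egCol fuel (setEntryG T im c (Letter.unprime w)) (c + 1) ⟨m.ceil, w.primed⟩
          else
            -- m = M off the main diagonal
            egCol fuel (setEntryG T im c w) (c + 1) m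
        else
          -- m < M : switch the primes on m and M, insert w+1 into the next column
          let iM := (occ.getD kM (0, default)).1
          let M := (occ.getD kM (0, default)).2
          let p := switchPrimes m M
          egCol fuel (setEntryG (setEntryG T im c p.1) iM c p.2) (c + 1) (Letter.succL w)

/-- Row-insertion stage of orthogonal Edelman–Greene insertion:
insert letter `w` into row `r` of `T`. -/
def egRow : ℕ → STab → ℕ → Letter → STab × Bool
  | 0, T, _, _ => (T, true)
  | fuel + 1, T, r, w =>
    let row := T.getD r []
    match row.findIdx? (fun x => decide (w.ceil < x.ceil)) with
    | none =>
        if row.isEmpty ∧ w.primed then (setRowG T r [Letter.unprime w], true)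
        else (setRowG T r (row ++ [w]), false)
    | some kM =>
        let km := (row.findIdx? (fun x => decide (w.ceil ≤ x.ceil))).getD kM
        let m := row.getD km default
        if km = kM then
          if km = 0 then
            -- m = M on the main diagonal
            egCol fuel (setRowG T r (row.set 0 (Letter.unprime w))) (r + 1)
              ⟨m.ceil, w.primed⟩
          else
            -- m = M off the main diagonal
            egRow fuel (setRowG T r (row.set km w)) (r + 1) m
        else
          -- m < M : switch primes; insert w+1 into the next column (if m is on the
          -- main diagonal) or the next row (otherwise)
          let M := row.getD kM default
          let p := switchPrimes m M
          let row' := (row.set km p.1).set kM p.2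
          if km = 0 then egCol fuel (setRowG T r row') (r + 1) (Letter.succL w)
          else egRow fuel (setRowG T r row') (r + 1) (Letter.succL w)

/-- `T ←ᴼ u` together with the flag recording whether the insertion ended in
column insertion. -/
def egInsert (T : STab) (u : Letter) : STab × Bool :=
  egRow (T.flatten.length + T.length + 2) T 0 u

/-- The orthogonal Edelman–Greene insertion tableau `P_EGᴼ(a)`. -/
def PEG (a : PWord) : STab := a.foldl (fun T u => (egInsert T u).1) []

/-- Add the recording letter `x` to `Q` in the unique box of `Pnew` not in `Pold`. -/
def addBox (Q Pold Pnew : STab) (x : Letter) : STab :=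
  match (List.range Pnew.length).find?
      (fun r => decide ((Pold.getD r []).length ≠ (Pnew.getD r []).length)) with
  | some r => setRowG Q r ((Q.getD r []) ++ [x])
  | none => Q

def QEGaux : STab → STab → ℕ → PWord → STab
  | _, Q, _, [] => Q
  | P, Q, n, u :: rest =>
      let res := egInsert P u
      QEGaux res.1 (addBox Q P res.1 ⟨(n : ℤ), res.2⟩) (n + 1) rest

/-- The orthogonal Edelman–Greene recording tableau `Q_EGᴼ(a)`. -/
def QEG (a : PWord) : STab := QEGaux [] [] 1 a

/-! ## Orthogonal Coxeter–Knuth operators -/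

def ock1 (x : Letter) : Letter := ⟨x.ceil, !x.primed⟩

def ock2 (x y : Letter) : Letter × Letter := (⟨y.ceil, x.primed⟩, ⟨x.ceil, y.primed⟩)

def ock3 (x y z : Letter) : Letter × Letter × Letter :=
  if x.ceil = z.ceil ∧ (x.ceil - y.ceil = 1 ∨ y.ceil - x.ceil = 1) then
    if x.primed = false ∧ y.primed = false ∧ z.primed = false then
      -- XYX ↔ YXY
      (⟨y.ceil, false⟩, ⟨x.ceil, false⟩, ⟨y.ceil, false⟩)
    else if x.primed = true ∧ y.primed = false ∧ z.primed = false then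
      -- X'YX ↦ YXY'
      (⟨y.ceil, false⟩, ⟨x.ceil, false⟩, ⟨y.ceil, true⟩)
    else if x.primed = false ∧ y.primed = false ∧ z.primed = true then
      -- YXY' ↦ X'YX
      (⟨y.ceil, true⟩, ⟨x.ceil, false⟩, ⟨y.ceil, false⟩)
    else (x, y, z)
  else if (x.ceil < z.ceil ∧ z.ceil < y.ceil) ∨ (y.ceil < z.ceil ∧ z.ceil < x.ceil) then
    -- ACB ↔ CAB
    (y, x, z)
  else if (y.ceil < x.ceil ∧ x.ceil < z.ceil) ∨ (z.ceil < x.ceil ∧ x.ceil < y.ceil) then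
    -- BCA ↔ BAC
    (x, z, y)
  else (x, y, z)

/-- The operator `ock_i` for `i ∈ ℤ`. -/
def ockW (i : ℤ) (a : PWord) : PWord :=
  if i = -1 then
    match a with
    | [] => []
    | x :: rest => ock1 x :: rest
  else if i = 0 then
    match a with
    | x :: y :: rest => (ock2 x y).1 :: (ock2 x y).2 :: rest
    | _ => a
  else if 1 ≤ i ∧ i + 2 ≤ (a.length : ℤ) then
    let k := (i - 1).toNat
    match a[k]?, a[k + 1]?, a[k + 2]? with
    | some x, some y, some z =>
        a.take k ++ [(ock3 x y z).1, (ock3 x y z).2.1, (ock3 x y z).2.2] ++ a.drop (k + 3)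
    | _, _, _ => a
  else a

/-- Orthogonal Coxeter–Knuth equivalence: generated by `a ∼ ock_i(a)` for all `i ∈ ℤ`. -/
def OckEquiv : PWord → PWord → Prop :=
  Relation.EqvGen (fun a b => ∃ i : ℤ, b = ockW i a)
/-! ## Descents -/

/-- Descent set of a primed word (as a set of 1-based positions). -/
def DesWord (a : PWord) : Set ℤ :=
  {i | ∃ k : ℕ, i = (k : ℤ) + 1 ∧ ∃ x y, a[k]? = some x ∧ a[k + 1]? = some y ∧ y < x}

/-- Descent set of a standard shifted tableau. -/
def DesT (T : STab) : Set ℤ :=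
  {i | 0 < i ∧ (
    (∃ r c r' c', entry? T r c = some ⟨i, false⟩ ∧
        entry? T r' c' = some ⟨i + 1, false⟩ ∧ r < r') ∨
    (∃ r c r' c', entry? T r c = some ⟨i, true⟩ ∧
        entry? T r' c' = some ⟨i + 1, true⟩ ∧ c < c') ∨
    (∃ r c r' c', entry? T r c = some ⟨i, false⟩ ∧
        entry? T r' c' = some ⟨i + 1, true⟩))}

/-! ## Dual equivalence operators on standard shifted tableaux -/

def numPrimes (T : STab) : ℕ := T.flatten.countP (fun x => x.primed)

/-- The entries of column `c`, read from bottom to top (increasing). -/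
def colLetters (T : STab) (c : ℕ) : PWord :=
  (List.range (c + 1)).filterMap (fun r => entry? T r c)

/-- The shifted reading word `unprime(C_q R_q ⋯ C_1 R_1)`. -/
def shword (T : STab) : List ℤ :=
  (((List.range (numCols T)).reverse).flatMap (fun idx =>
    (colLetters T idx).filter (fun x => x.primed) ++
      ((T.getD idx []).filter (fun x => !x.primed)))).map Letter.ceil

def idxOfZ (v : ℤ) : List ℤ → ℕ
  | [] => 0
  | x :: r => if x = v then 0 else idxOfZ v r + 1

def positionsOf (T : STab) : List (ℕ × ℕ) :=
  (List.range T.length).flatMap (fun r =>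
    (List.range (T.getD r []).length).map (fun k => (r, r + k)))

/-- The box `□_v` of `T` containing `v` or `v'`. -/
def boxOf (T : STab) (v : ℤ) : Option (ℕ × ℕ) :=
  (positionsOf T).find? (fun p =>
    match entry? T p.1 p.2 with
    | some x => decide (x.ceil = v)
    | none => false)

/-- Reverse the prime of the entry in position `(r, c)`. -/
def togglePos (T : STab) (r c : ℕ) : STab :=
  match entry? T r c with
  | some x => setEntryG T r c ⟨x.ceil, !x.primed⟩
  | none => T

/-- Switch the primes of the entries in the two given positions. -/
def switchAt (T : STab) (p q : ℕ × ℕ) : STab :=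
  match entry? T p.1 p.2, entry? T q.1 q.2 with
  | some x, some y =>
      if x.primed = y.primed then T else togglePos (togglePos T p.1 p.2) q.1 q.2
  | _, _ => T

/-- The row index of `□_v` if it is a main-diagonal box. -/
def diagBox? (T : STab) (v : ℤ) : Option ℕ :=
  (boxOf T v).bind (fun p => if p.1 = p.2 then some p.1 else none)

def switchDiag (T T' : STab) (u v : ℤ) : STab :=
  match diagBox? T u, diagBox? T v with
  | some r, some s => switchAt T' (r, r) (s, s)
  | _, _ => T'

/-- The operator `𝔰_i`. -/
def sOp (i : ℤ) (T : STab) : STab :=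
  match boxOf T i, boxOf T (i + 1) with
  | some (r1, c1), some (r2, c2) =>
      if r1 ≠ r2 ∧ c1 ≠ c2 then
        -- swap i ↔ i+1 and i' ↔ (i+1)'
        setEntryG (setEntryG T r1 c1 ⟨i + 1, ((entry? T r1 c1).getD default).primed⟩)
          r2 c2 ⟨i, ((entry? T r2 c2).getD default).primed⟩
      else if r1 ≠ c1 ∧ r2 ≠ c2 then
        -- same row or column, neither box diagonal: reverse both primes
        togglePos (togglePos T r1 c1) r2 c2
      else
        -- same row or column, one box diagonal
        let T1 := if r1 = c1 then togglePos T r2 c2 else togglePos T r1 c1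
        let T2 :=
          if 1 ≤ i - 1 ∧ (diagBox? T (i - 1)).isSome ∧ (diagBox? T (i + 1)).isSome then
            switchDiag T T1 (i - 1) (i + 1)
          else T1
        if i + 2 ≤ (T.flatten.length : ℤ) ∧ (diagBox? T i).isSome ∧
            (diagBox? T (i + 2)).isSome then
          switchDiag T T2 i (i + 2)
        else T2
  | _, _ => T

def btwn (a m b : ℕ) : Prop := (a < m ∧ m < b) ∨ (b < m ∧ m < a)

instance (a m b : ℕ) : Decidable (btwn a m b) := by unfold btwn; infer_instance

/-- The dual equivalence operator `𝔡_i` for `i ∈ ℤ`. -/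
def dOp (i : ℤ) (T : STab) : STab :=
  if ¬(1 ≤ i + 2 ∧ i + 2 ≤ (T.flatten.length : ℤ)) then T
  else if i = -1 then togglePos T 0 0
  else if i = 0 then togglePos T 0 1
  else
    let w := shword T
    if btwn (idxOfZ i w) (idxOfZ (i + 2) w) (idxOfZ (i + 1) w) then sOp i T
    else if btwn (idxOfZ (i + 1) w) (idxOfZ i w) (idxOfZ (i + 2) w) then sOp (i + 1) T
    else T

/-! ## Marked cycles -/

/-- The 2-cycles of `z`, as ordered pairs `(i, j)` with `i < j = z(i)`. -/
def cycSet (z : Equiv.Perm ℤ) : Set (ℤ × ℤ) := {p | p.1 < p.2 ∧ z p.1 = p.2}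

/-- `s_{a_n} ⋯ s_{a_{k+2}} s_{a_{k+1}}` (ordinary product; 0-based index `k`). -/
def suffixPerm (a : List ℤ) (k : ℕ) : Equiv.Perm ℤ :=
  ((a.drop (k + 1)).reverse.map sPerm).prod

/-- `γ_{k+1}(a)` as an ordered pair (junk value `(0,0)` off the commutation set). -/
def gammaPair (a : List ℤ) (k : ℕ) : ℤ × ℤ :=
  match a[k]? with
  | some x => (min (suffixPerm a k x) (suffixPerm a k (x + 1)),
               max (suffixPerm a k x) (suffixPerm a k (x + 1)))
  | none => (0, 0)
/-! ## Increasing factorization sequences and Schur Q-functions -/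

/-- `Incr_∞(R_inv^+(z))`: sequences of weakly increasing primed words, all but
finitely many empty, whose concatenation is a primed involution word for `z`. -/
def IncrSeq (z : Equiv.Perm ℤ) : Set (ℕ → PWord) :=
  {φ | (∀ n, List.Chain' (· ≤ ·) (φ n)) ∧
    ∃ N, (∀ n, N ≤ n → φ n = []) ∧ ((List.range N).map φ).flatten ∈ RinvPlus z}

/-- Least bound past which a sequence of words is empty. -/
noncomputable def seqBound (φ : ℕ → PWord) : ℕ := sInf {N | ∀ n, N ≤ n → φ n = []}

/-- The concatenation `a^1 a^2 ⋯` of a sequence of words. -/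
noncomputable def concatSeq (φ : ℕ → PWord) : PWord :=
  ((List.range (seqBound φ)).map φ).flatten

/-- `ℓ(a^1) + ⋯ + ℓ(a^i)`. -/
def prefLen (φ : ℕ → PWord) (i : ℕ) : ℕ := (((List.range i).map φ).map List.length).sum

/-- The minimal `i ≥ 1` with `j ≤ ℓ(a^1) + ⋯ + ℓ(a^i)`. -/
noncomputable def relabel (φ : ℕ → PWord) (j : ℤ) : ℤ :=
  ((sInf {i : ℕ | 1 ≤ i ∧ j ≤ (prefLen φ i : ℤ)} : ℕ) : ℤ)

/-- The semistandard recording tableau `Q_EGᴼ(φ)`. -/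
noncomputable def QEGseq (φ : ℕ → PWord) : STab :=
  (QEG (concatSeq φ)).map (List.map (fun x => (⟨relabel φ x.ceil, x.primed⟩ : Letter)))

/-- The insertion tableau `P_EGᴼ(φ)`. -/
noncomputable def PEGseq (φ : ℕ → PWord) : STab := PEG (concatSeq φ)

/-- The Schur Q-function of a strict partition: the coefficient of the monomial with
exponent vector `d` is the number of semistandard shifted tableaux `T` of the given
shape with `x^T = x^d`. -/
noncomputable def SchurQ (sh : List ℕ) : MvPowerSeries ℤ ℤ :=
  fun d => (({T : STab | shapeOf T = sh ∧ IsSemistandard T ∧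
    ∀ i : ℤ, d i = T.flatten.countP (fun x => decide (x.ceil = i))} : Set STab).ncard : ℤ)

/-- `Q_z = Σ_{φ ∈ Incr_∞(R_inv^+(z))} x^φ`. -/
noncomputable def Qz (z : Equiv.Perm ℤ) : MvPowerSeries ℤ ℤ :=
  fun d => (({φ : ℕ → PWord | φ ∈ IncrSeq z ∧
    (∀ i : ℕ, d ((i : ℤ) + 1) = (φ i).length) ∧
    (∀ j : ℤ, j ≤ 0 → d j = 0)} : Set (ℕ → PWord)).ncard : ℤ)

/-! ## Dominant involutions -/

/-- The shifted diagram `SD_λ ⊆ ℤ × ℤ` of a strict partition. -/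
def SDset (sh : List ℕ) : Set (ℤ × ℤ) :=
  {p | ∃ i j : ℕ, 1 ≤ i ∧ i ≤ sh.length ∧ 1 ≤ j ∧ j ≤ sh.getD (i - 1) 0 ∧
    p.1 = (i : ℤ) ∧ p.2 = (i : ℤ) + (j : ℤ) - 1}

/-- The involution Rothe diagram `D̂(z) = {(i,j) : z(i) > j ≤ i < z(j)}`. -/
def invRothe (z : Equiv.Perm ℤ) : Set (ℤ × ℤ) :=
  {p | p.2 < z p.1 ∧ p.2 ≤ p.1 ∧ p.1 < z p.2}

/-- The tableau `T_λ` with entry `i + j - 1` in box `(i, j)` of `SD_λ`. -/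
def Tlam (sh : List ℕ) : STab :=
  (List.range sh.length).map (fun r =>
    (List.range (sh.getD r 0)).map (fun k =>
      (⟨2 * (r : ℤ) + (k : ℤ) + 1, false⟩ : Letter)))

/-- The permutation `i + m ↦ w(i) + m` (fixing everything outside `m + support`). -/
def shiftPerm (m : ℕ) (w : Equiv.Perm ℤ) : Equiv.Perm ℤ :=
  (Equiv.addLeft (m : ℤ)).permCongr w

/-- `z ∈ S_m`: `z` fixes every point outside `[1, m]`. -/
def SupportedOn (z : Equiv.Perm ℤ) (m : ℕ) : Prop :=
  ∀ x : ℤ, x < 1 ∨ (m : ℤ) < x → z x = x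
/-! ## Primed compatible sequences -/

/-- A primed compatible sequence, recorded as the list of its columns `(index; value)`. -/
def IsPrimedCompatible (φ : List (ℕ × Letter)) : Prop :=
  (∀ p ∈ φ, 0 < p.1 ∧ 0 < p.2.ceil) ∧
  List.Chain' (fun p q : ℕ × Letter => p.1 ≤ q.1 ∧ (p.1 = q.1 → p.2 ≤ q.2)) φ ∧
  (∀ (k l : ℕ) (p : ℕ × Letter), k < l → φ[k]? = some p → φ[l]? = some p →
    p.2.primed = false)

def IsIndexStrict (φ : List (ℕ × Letter)) : Prop :=
  List.Chain' (fun p q : ℕ × Letter => p.1 < q.1) φ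

/-! ## Sagan–Worley insertion (orthogonal and symplectic versions) -/

/-- Whether `u` bumps `v`: strict comparison when inserting an unprimed letter into a
row or a primed letter into a column, weak comparison otherwise. -/
def swBump (isRow : Bool) (u v : Letter) : Bool :=
  if (isRow && !u.primed) || (!isRow && u.primed) then decide (u < v) else decide (u ≤ v)

/-- Column stage of orthogonal Sagan–Worley insertion. -/
def swColO : ℕ → STab → ℕ → Letter → STab × Bool
  | 0, T, _, _ => (T, true)
  | fuel + 1, T, c, u =>
    let occ := (List.range (c + 1)).filterMap (fun r => (entry? T r c).map (fun x => (r, x)))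
    match occ.find? (fun p => swBump false u p.2) with
    | none =>
        let r := occ.length
        let u' := if r = c ∧ u.primed then Letter.unprime u else u
        (setRowG T r ((T.getD r []) ++ [u']), true)
    | some p =>
        if p.1 = c then
          if u.ceil = p.2.ceil then swColO fuel T (c + 1) (Letter.unprime p.2)
          else
            let q := switchPrimes u p.2
            swColO fuel (setEntryG T p.1 c q.1) (c + 1) q.2
        else swColO fuel (setEntryG T p.1 c u) (c + 1) p.2

/-- Row stage of orthogonal Sagan–Worley insertion. -/
def swRowO : ℕ → STab → ℕ → Letter → STab × Bool
  | 0, T, _, _ => (T, true)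
  | fuel + 1, T, r, u =>
    let row := T.getD r []
    match row.findIdx? (fun v => swBump true u v) with
    | none =>
        if row.isEmpty ∧ u.primed then (setRowG T r [Letter.unprime u], true)
        else (setRowG T r (row ++ [u]), false)
    | some k =>
        let v := row.getD k default
        if k = 0 then
          if u.ceil = v.ceil then swColO fuel T (r + 1) (Letter.unprime v)
          else
            let q := switchPrimes u v
            swColO fuel (setRowG T r (row.set 0 q.1)) (r + 1) q.2
        else swRowO fuel (setRowG T r (row.set k u)) (r + 1) v

def swInsertO (T : STab) (u : Letter) : STab × Bool :=
  swRowO (T.flatten.length + T.length + 2) T 0 u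

/-- Column stage of symplectic (original) Sagan–Worley insertion. -/
def swColSp : ℕ → STab → ℕ → Letter → STab × Bool
  | 0, T, _, _ => (T, true)
  | fuel + 1, T, c, u =>
    let occ := (List.range (c + 1)).filterMap (fun r => (entry? T r c).map (fun x => (r, x)))
    match occ.find? (fun p => swBump false u p.2) with
    | none => (setRowG T occ.length ((T.getD occ.length []) ++ [u]), true)
    | some p =>
        if p.1 = c then
          if u.ceil = p.2.ceil then swColSp fuel T (c + 1) (Letter.unprime p.2)
          else swColSp fuel (setEntryG T p.1 c u) (c + 1) p.2
        else swColSp fuel (setEntryG T p.1 c u) (c + 1) p.2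

/-- Row stage of symplectic (original) Sagan–Worley insertion. -/
def swRowSp : ℕ → STab → ℕ → Letter → STab × Bool
  | 0, T, _, _ => (T, true)
  | fuel + 1, T, r, u =>
    let row := T.getD r []
    match row.findIdx? (fun v => swBump true u v) with
    | none => (setRowG T r (row ++ [u]), false)
    | some k =>
        let v := row.getD k default
        if k = 0 then
          if u.ceil = v.ceil then swColSp fuel T (r + 1) (Letter.unprime v)
          else swColSp fuel (setRowG T r (row.set 0 u)) (r + 1) v
        else swRowSp fuel (setRowG T r (row.set k u)) (r + 1) v

def swInsertSp (T : STab) (u : Letter) : STab × Bool :=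
  swRowSp (T.flatten.length + T.length + 2) T 0 u

def PSWO (φ : List (ℕ × Letter)) : STab := φ.foldl (fun T p => (swInsertO T p.2).1) []

def PSWSp (φ : List (ℕ × Letter)) : STab := φ.foldl (fun T p => (swInsertSp T p.2).1) []

def QSWaux (ins : STab → Letter → STab × Bool) : STab → STab → List (ℕ × Letter) → STab
  | _, Q, [] => Q
  | P, Q, p :: rest =>
      let res := ins P p.2
      QSWaux ins res.1 (addBox Q P res.1 ⟨(p.1 : ℤ), res.2⟩) rest

def QSWO (φ : List (ℕ × Letter)) : STab := QSWaux swInsertO [] [] φ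

def QSWSp (φ : List (ℕ × Letter)) : STab := QSWaux swInsertSp [] [] φ

/-- Entry `A_{ij}` of the circled matrix of `φ` (forgetting the circles). -/
def cmEntry (φ : List (ℕ × Letter)) (i j : ℕ) : ℕ :=
  φ.countP (fun p => decide (p.1 = i ∧ p.2.ceil = (j : ℤ)))

/-! ## Shifted mixed insertion (orthogonal and symplectic versions) -/

/-- Tableaux whose entries are signed letters `(ε, u)`, `ε ∈ {+, -}`
(`true` records the sign `-`). -/
abbrev MTab := List (List (Bool × Letter))

def extractO (U : MTab) : STab :=
  U.map (fun row =>
    match row with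
    | [] => []
    | (e, x) :: rest => (if e then (⟨x.ceil, true⟩ : Letter) else x) :: rest.map Prod.snd)

def extractSp (U : MTab) : STab := U.map (List.map Prod.snd)

/-- One mixed insertion, of the pair `β` into row (`isCol = false`) or column
(`isCol = true`) number `idx`; returns the tableau and the added box. -/
def hmIns (sympl : Bool) : ℕ → MTab → Bool → ℕ → Bool × Letter → MTab × (ℕ × ℕ)
  | 0, T, _, _, _ => (T, (0, 0))
  | fuel + 1, T, isCol, idx, β =>
    if isCol then
      let c := idx
      let occ := (List.range (c + 1)).filterMap
        (fun r => (entryG? T r c).map (fun x => (r, x)))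
      match occ.find? (fun p => decide (β.2 < p.2.2)) with
      | none =>
          let r := occ.length
          (setRowG T r ((T.getD r []) ++ [β]), (r, c))
      | some p =>
          if p.1 = c then
            hmIns sympl fuel
              (setEntryG T p.1 c (if sympl then (p.2.1, β.2) else β)) true (c + 1)
              (if sympl then (β.1, ⟨p.2.2.ceil, true⟩) else (p.2.1, ⟨p.2.2.ceil, true⟩))
          else
            hmIns sympl fuel (setEntryG T p.1 c (p.2.1, β.2)) p.2.2.primed
              (if p.2.2.primed then c + 1 else p.1 + 1) (β.1, p.2.2)
    else
      let r := idx
      let row := T.getD r []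
      match row.findIdx? (fun p => decide (β.2 < p.2)) with
      | none => (setRowG T r (row ++ [β]), (r, r + row.length))
      | some k =>
          let q := row.getD k default
          if k = 0 then
            hmIns sympl fuel
              (setRowG T r (row.set 0 (if sympl then (q.1, β.2) else β))) true (r + 1)
              (if sympl then (β.1, ⟨q.2.ceil, true⟩) else (q.1, ⟨q.2.ceil, true⟩))
          else
            hmIns sympl fuel (setRowG T r (row.set k (q.1, β.2))) q.2.primed
              (if q.2.primed then r + k + 1 else r + 1) (β.1, q.2)

def hmInsert (sympl : Bool) (T : MTab) (x : Letter) : MTab × (ℕ × ℕ) :=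
  hmIns sympl (2 * T.flatten.length + 4) T false 0 (x.primed, ⟨x.ceil, false⟩)

def hmAuxCS (sympl : Bool) : MTab → STab → List (ℕ × Letter) → MTab × STab
  | U, Q, [] => (U, Q)
  | U, Q, p :: rest =>
      let res := hmInsert sympl U p.2
      let pos := res.2
      let sgn := ((entryG? res.1 pos.1 pos.2).map Prod.fst).getD false
      let pr : Bool := if sympl then sgn else (decide (pos.1 ≠ pos.2) && sgn)
      hmAuxCS sympl res.1
        (setRowG Q pos.1 ((Q.getD pos.1 []) ++ [(⟨(p.1 : ℤ), pr⟩ : Letter)])) rest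

def PHMO (φ : List (ℕ × Letter)) : STab := extractO (hmAuxCS false [] [] φ).1
def QHMO (φ : List (ℕ × Letter)) : STab := (hmAuxCS false [] [] φ).2
def PHMSp (φ : List (ℕ × Letter)) : STab := extractSp (hmAuxCS true [] [] φ).1
def QHMSp (φ : List (ℕ × Letter)) : STab := (hmAuxCS true [] [] φ).2

/-- A primed word, identified with the primed compatible sequence with
index row `1, 2, …, n`. -/
def wordCS (a : PWord) : List (ℕ × Letter) :=
  ((List.range a.length).zip a).map (fun p => (p.1 + 1, p.2))

/-! ## The transpose of a primed compatible sequence -/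

def insSortedCS (p : ℕ × Letter) : List (ℕ × Letter) → List (ℕ × Letter)
  | [] => [p]
  | q :: rest =>
      if p.1 < q.1 ∨ (p.1 = q.1 ∧ p.2 ≤ q.2) then p :: q :: rest
      else q :: insSortedCS p rest

def sortCS (l : List (ℕ × Letter)) : List (ℕ × Letter) := l.foldr insSortedCS []

/-- `φ^⊤`: move each prime from the value to the index above it, interchange the two
rows, and reorder the columns lexicographically. -/
def transposeCS (φ : List (ℕ × Letter)) : List (ℕ × Letter) :=
  sortCS (φ.map (fun p => (p.2.ceil.toNat, (⟨(p.1 : ℤ), p.2.primed⟩ : Letter))))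

/-- One step of the relation `≡`: a braid move `X(X+1)X ∼ (X+1)X(X+1)`, a commutation
`XY ∼ YX` for `|X - Y| > 1`, or a swap of the first two letters. -/
inductive IWStep : List ℤ → List ℤ → Prop
  | braid (u v : List ℤ) (x : ℤ) :
      IWStep (u ++ [x, x + 1, x] ++ v) (u ++ [x + 1, x, x + 1] ++ v)
  | comm (u v : List ℤ) (x y : ℤ) (h : 1 < |x - y|) :
      IWStep (u ++ [x, y] ++ v) (u ++ [y, x] ++ v)
  | init (v : List ℤ) (x y : ℤ) : IWStep ([x, y] ++ v) ([y, x] ++ v)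

/-- The equivalence relation `≡` generated by the above moves. -/
def iwEquiv : List ℤ → List ℤ → Prop := Relation.EqvGen IWStep

/-! ### Demazure multiplication on the two sides -/

/-- The right Demazure product `σ ∘ s_i`. -/
def demazureRight (σ : Equiv.Perm ℤ) (i : ℤ) : Equiv.Perm ℤ :=
  if σ i < σ (i + 1) then σ * sPerm i else σ

/-- The left Demazure product `s_i ∘ σ`. -/
def demazureLeft (i : ℤ) (σ : Equiv.Perm ℤ) : Equiv.Perm ℤ :=
  if σ⁻¹ i < σ⁻¹ (i + 1) then sPerm i * σ else σ

/-- The twisted conjugation `s_i ∘ σ ∘ s_i`. -/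
def demazureConj (σ : Equiv.Perm ℤ) (i : ℤ) : Equiv.Perm ℤ :=
  demazureLeft i (demazureRight σ i)

lemma sPerm_apply (i x : ℤ) :
    sPerm i x = if x = i then i + 1 else if x = i + 1 then i else x := by
  simp [sPerm, Equiv.swap_apply_def]

lemma sPerm_inv (i : ℤ) : (sPerm i)⁻¹ = sPerm i := by simp [sPerm]

lemma heckeProd_eq_foldl (w : List ℤ) : heckeProd w = w.foldl demazureRight 1 := rfl

lemma sPerm_comm {x y : ℤ} (h : 1 < |x - y|) : sPerm x * sPerm y = sPerm y * sPerm x := by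
  ext t
  simp only [Equiv.Perm.mul_apply, sPerm_apply]
  rcases lt_abs.1 h with h | h <;> split_ifs <;> omega

lemma sPerm_braid (x : ℤ) :
    sPerm x * sPerm (x + 1) * sPerm x = sPerm (x + 1) * sPerm x * sPerm (x + 1) := by
  ext t
  simp only [Equiv.Perm.mul_apply, sPerm_apply]
  split_ifs <;> omega

lemma demazureRight_self (σ : Equiv.Perm ℤ) (x : ℤ) :
    demazureRight (demazureRight σ x) x = demazureRight σ x := by
  unfold demazureRight
  split_ifs with h h'
  · simp only [Equiv.Perm.mul_apply, sPerm_apply] at h'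
    simp at h'
    omega
  · rfl
  · rfl

lemma demazureRight_comm (σ : Equiv.Perm ℤ) {x y : ℤ} (h : 1 < |x - y|) :
    demazureRight (demazureRight σ x) y = demazureRight (demazureRight σ y) x := by
  have hc := sPerm_comm h
  have h1 : sPerm x y = y ∧ sPerm x (y + 1) = y + 1 ∧ sPerm y x = x ∧
      sPerm y (x + 1) = x + 1 := by
    simp only [sPerm_apply]
    rcases lt_abs.1 h with h | h <;> split_ifs <;> omega
  obtain ⟨h1, h2, h3, h4⟩ := h1
  unfold demazureRight
  by_cases p : σ x < σ (x + 1) <;> by_cases q : σ y < σ (y + 1) <;>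
    simp [p, q, h1, h2, h3, h4, hc, mul_assoc, -not_lt]

lemma demazureRight_braid (σ : Equiv.Perm ℤ) (x : ℤ) :
    demazureRight (demazureRight (demazureRight σ x) (x + 1)) x =
      demazureRight (demazureRight (demazureRight σ (x + 1)) x) (x + 1) := by
  have hb := sPerm_braid x
  have e1 : sPerm x x = x + 1 := by simp [sPerm_apply]
  have e2 : sPerm x (x + 1) = x := by simp [sPerm_apply]
  have e3 : sPerm x (x + 1 + 1) = x + 1 + 1 := by
    rw [sPerm_apply]; split_ifs <;> omega
  have e4 : sPerm (x + 1) x = x := by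
    rw [sPerm_apply]; split_ifs <;> omega
  have e5 : sPerm (x + 1) (x + 1) = x + 1 + 1 := by simp [sPerm_apply]
  have e6 : sPerm (x + 1) (x + 1 + 1) = x + 1 := by simp [sPerm_apply]
  have n1 : σ x ≠ σ (x + 1) := by simp
  have n2 : σ x ≠ σ (x + 1 + 1) := fun h => by have := σ.injective h; omega
  have n3 : σ (x + 1) ≠ σ (x + 1 + 1) := by simp
  rw [mul_assoc, mul_assoc] at hb
  rcases lt_or_gt_of_ne n1 with a | a <;> rcases lt_or_gt_of_ne n2 with b | b <;>
    rcases lt_or_gt_of_ne n3 with c | c <;>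
    first
    | (exfalso; omega)
    | simp [demazureRight, Equiv.Perm.mul_apply, e1, e2, e3, e4, e5, e6, a, b, c, not_lt_of_gt, hb,
        mul_assoc]

lemma demazureLeft_inv (i : ℤ) (σ : Equiv.Perm ℤ) :
    demazureLeft i σ⁻¹ = (demazureRight σ i)⁻¹ := by
  unfold demazureLeft demazureRight
  split_ifs <;> simp_all [sPerm_inv]

lemma demazureLeft_demazureRight (i j : ℤ) (σ : Equiv.Perm ℤ) :
    demazureLeft i (demazureRight σ j) = demazureRight (demazureLeft i σ) j := by
  have hs : ∀ k x : ℤ, sPerm k x = if x = k then k + 1 else if x = k + 1 then k else x :=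
    sPerm_apply
  have hj : σ⁻¹ (σ j) = j := by simp
  have hj' : σ⁻¹ (σ (j + 1)) = j + 1 := by simp
  have hi : σ (σ⁻¹ i) = i := by simp
  have hi' : σ (σ⁻¹ (i + 1)) = i + 1 := by simp
  have hne : σ j ≠ σ (j + 1) := by simp
  have hne' : σ⁻¹ i ≠ σ⁻¹ (i + 1) := by simp
  by_cases hA : σ j = i ∧ σ (j + 1) = i + 1
  · obtain ⟨a, b⟩ := hA
    have ha : σ⁻¹ i = j := by rw [← a, hj]
    have hb : σ⁻¹ (i + 1) = j + 1 := by rw [← b, hj']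
    have key : sPerm i * σ = σ * sPerm j := by
      ext t
      simp only [Equiv.Perm.mul_apply, hs]
      have t1 : σ t = i ↔ t = j := by rw [← a]; exact σ.injective.eq_iff
      have t2 : σ t = i + 1 ↔ t = j + 1 := by rw [← b]; exact σ.injective.eq_iff
      split_ifs <;> simp_all
    have e1 : demazureRight σ j = σ * sPerm j := by simp [demazureRight, a, b]
    have e2 : demazureLeft i σ = σ * sPerm j := by simp [demazureLeft, ha, hb, key]
    rw [e1, e2]
    rw [demazureLeft, demazureRight, if_neg, if_neg]
    · simp [hs, a, b]
    · rw [mul_inv_rev, sPerm_inv, Equiv.Perm.mul_apply, Equiv.Perm.mul_apply, ha, hb]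
      simp [hs]
  · have c1 : (sPerm i * σ) j < (sPerm i * σ) (j + 1) ↔ σ j < σ (j + 1) ∨
        (σ j = i + 1 ∧ σ (j + 1) = i) := by
      simp only [Equiv.Perm.mul_apply, hs]
      split_ifs <;> omega
    have c2 : (σ * sPerm j)⁻¹ i < (σ * sPerm j)⁻¹ (i + 1) ↔ σ⁻¹ i < σ⁻¹ (i + 1) ∨
        (σ⁻¹ i = j + 1 ∧ σ⁻¹ (i + 1) = j) := by
      have hA' : ¬ (σ⁻¹ i = j ∧ σ⁻¹ (i + 1) = j + 1) := by
        rintro ⟨a, b⟩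
        exact hA ⟨by rw [← a, hi], by rw [← b, hi']⟩
      simp only [mul_inv_rev, sPerm_inv, Equiv.Perm.mul_apply, hs]
      split_ifs <;> omega
    by_cases hB : σ j = i + 1 ∧ σ (j + 1) = i
    · obtain ⟨a, b⟩ := hB
      have ha : σ⁻¹ (i + 1) = j := by rw [← a, hj]
      have hb : σ⁻¹ i = j + 1 := by rw [← b, hj']
      simp [demazureLeft, demazureRight, ha, hb, a, b]
    · have hB' : ¬ (σ⁻¹ i = j + 1 ∧ σ⁻¹ (i + 1) = j) := by
        rintro ⟨a, b⟩
        exact hB ⟨by rw [← b, hi'], by rw [← a, hi]⟩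
      simp only [hB, hB', or_false] at c1 c2
      unfold demazureLeft demazureRight
      by_cases p : σ j < σ (j + 1) <;> by_cases q : σ⁻¹ i < σ⁻¹ (i + 1) <;>
        simp only [p, q, c1, c2, if_true, if_false, mul_assoc]

lemma heckeProd_concat (w : List ℤ) (i : ℤ) :
    heckeProd (w ++ [i]) = demazureRight (heckeProd w) i := by
  simp [heckeProd_eq_foldl]

lemma heckeProd_cons (i : ℤ) (w : List ℤ) :
    heckeProd (i :: w) = demazureLeft i (heckeProd w) := by
  induction w using List.reverseRecOn with
  | nil => simp [heckeProd_eq_foldl, demazureLeft, demazureRight]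
  | append_singleton w j ih =>
    rw [← List.cons_append, heckeProd_concat, heckeProd_concat, ih,
      demazureLeft_demazureRight]

lemma heckeProd_reverse (w : List ℤ) : heckeProd w.reverse = (heckeProd w)⁻¹ := by
  induction w using List.reverseRecOn with
  | nil => simp [heckeProd_eq_foldl]
  | append_singleton w j ih =>
    rw [List.reverse_append, List.reverse_singleton, List.singleton_append, heckeProd_cons, ih,
      demazureLeft_inv, heckeProd_concat]

lemma heckeProd_congr {p q : List ℤ}
    (h : ∀ σ, p.foldl demazureRight σ = q.foldl demazureRight σ) (u v : List ℤ) :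
    heckeProd (u ++ p ++ v) = heckeProd (u ++ q ++ v) := by
  simp only [heckeProd_eq_foldl, List.foldl_append, h]

lemma heckeProd_apply_of_lt {w : List ℤ} {N t : ℤ} (hw : ∀ x ∈ w, x ≤ N) (ht : N + 1 < t) :
    heckeProd w t = t := by
  induction w using List.reverseRecOn with
  | nil => simp [heckeProd_eq_foldl]
  | append_singleton w j ih =>
    have hj : j ≤ N := hw j (by simp)
    have hs : sPerm j t = t := by rw [sPerm_apply]; split_ifs <;> omega
    have := ih fun x hx => hw x (by simp [hx])
    rw [heckeProd_concat, demazureRight]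
    split_ifs <;> simp [hs, this]

lemma finite_support_heckeProd (w : List ℤ) : {x : ℤ | heckeProd w x ≠ x}.Finite := by
  induction w using List.reverseRecOn with
  | nil => simp [heckeProd_eq_foldl]
  | append_singleton w j ih =>
    refine (ih.union (Set.toFinite {j, j + 1})).subset fun x hx => ?_
    rw [Set.mem_ofPred_eq, heckeProd_concat, demazureRight] at hx
    by_contra hc
    simp only [Set.mem_union, Set.mem_ofPred_eq, Set.mem_insert_iff, Set.mem_singleton_iff,
      not_or, not_not] at hc
    have hs : sPerm j x = x := by simp [sPerm_apply, hc.2]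
    split_ifs at hx <;> simp [hs, hc.1] at hx

/-! ### The involution attached to a word -/

lemma invHecke_nil : invHecke [] = 1 := rfl

lemma invHecke_concat (w : List ℤ) (i : ℤ) :
    invHecke (w ++ [i]) = demazureConj (invHecke w) i := by
  cases w with
  | nil =>
    have h1 : demazureRight 1 i = sPerm i := by simp [demazureRight]
    have h2 : demazureLeft i (sPerm i) = sPerm i := by
      rw [demazureLeft, if_neg]
      simp [sPerm_inv, sPerm_apply]
    simp [invHecke, heckeProd_eq_foldl, demazureConj, h1, h2]
  | cons x t =>
    have : (x :: t ++ [i]).reverse ++ (x :: t ++ [i]).tail =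
        i :: (((x :: t).reverse ++ (x :: t).tail) ++ [i]) := by simp
    rw [invHecke, this, heckeProd_cons, heckeProd_concat, demazureConj, invHecke]

lemma invHecke_inv (w : List ℤ) : (invHecke w)⁻¹ = invHecke w := by
  rw [invHecke, ← heckeProd_reverse]
  cases w <;> simp

lemma IZ_invHecke (w : List ℤ) : IZ (invHecke w) := by
  refine ⟨finite_support_heckeProd _, ?_⟩
  nth_rw 1 [← invHecke_inv w]
  simp

lemma invHecke_apply_of_lt {w : List ℤ} {N t : ℤ} (hw : ∀ x ∈ w, x ≤ N) (ht : N + 1 < t) :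
    invHecke w t = t :=
  heckeProd_apply_of_lt
    (fun x hx => hw x (by
      rcases List.mem_append.1 hx with h | h
      · exact List.mem_reverse.1 h
      · exact List.mem_of_mem_tail h)) ht

lemma invHecke_congr_prefix {p q : List ℤ} (hp : p ≠ []) (hq : q ≠ [])
    (h : ∀ σ, (p.reverse ++ p.tail).foldl demazureRight σ =
      (q.reverse ++ q.tail).foldl demazureRight σ) (v : List ℤ) :
    invHecke (p ++ v) = invHecke (q ++ v) := by
  simpa [invHecke, List.tail_append_of_ne_nil hp, List.tail_append_of_ne_nil hq] using
    heckeProd_congr h v.reverse v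

lemma invHecke_congr {p q : List ℤ} (hp : p ≠ []) (hq : q ≠ [])
    (h : ∀ σ, p.foldl demazureRight σ = q.foldl demazureRight σ)
    (h' : ∀ σ, p.reverse.foldl demazureRight σ = q.reverse.foldl demazureRight σ)
    (h0 : ∀ σ, (p.reverse ++ p.tail).foldl demazureRight σ =
      (q.reverse ++ q.tail).foldl demazureRight σ) (u v : List ℤ) :
    invHecke (u ++ p ++ v) = invHecke (u ++ q ++ v) := by
  cases u with
  | nil => exact invHecke_congr_prefix hp hq h0 v
  | cons x t =>
    have e1 := heckeProd_congr h' v.reverse (t.reverse ++ x :: (t ++ p ++ v))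
    have e2 := heckeProd_congr h (v.reverse ++ q.reverse ++ t.reverse ++ x :: t) v
    simp only [List.append_assoc, List.cons_append] at e1 e2
    simpa [invHecke] using e1.trans e2

lemma invHecke_repeat (u v : List ℤ) (x : ℤ) :
    invHecke (u ++ [x, x] ++ v) = invHecke (u ++ [x] ++ v) := by
  apply invHecke_congr <;> simp [demazureRight_self]

lemma invHecke_eq_of_step {a b : List ℤ} (h : IWStep a b) : invHecke a = invHecke b := by
  cases h with
  | braid u v x =>
    apply invHecke_congr <;> simp [demazureRight_braid, demazureRight_self]
  | comm u v x y h =>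
    have hc := fun σ => demazureRight_comm σ h
    apply invHecke_congr <;> simp [hc, demazureRight_self]
  | init v x y =>
    refine invHecke_congr_prefix (by simp) (by simp) (fun σ => ?_) v
    simp only [List.reverse_cons, List.reverse_nil, List.nil_append, List.cons_append,
      List.tail_cons, List.foldl_cons, List.foldl_nil]
    by_cases h : 1 < |x - y|
    · rw [demazureRight_comm _ h, demazureRight_self, ← demazureRight_comm _ h,
        demazureRight_comm _ h, demazureRight_self]
    · have : x = y ∨ y = x + 1 ∨ x = y + 1 := by
        rw [lt_abs] at h
        omega
      rcases this with rfl | rfl | rfl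
      · rfl
      · rw [demazureRight_braid]
      · rw [demazureRight_braid]

lemma invHecke_eq_of_iwEquiv {a b : List ℤ} (h : iwEquiv a b) : invHecke a = invHecke b := by
  induction h with
  | rel a b h => exact invHecke_eq_of_step h
  | refl a => rfl
  | symm a b _ ih => exact ih.symm
  | trans a b c _ _ ih ih' => exact ih.trans ih'

lemma length_eq_of_iwEquiv {a b : List ℤ} (h : iwEquiv a b) : a.length = b.length := by
  induction h with
  | rel a b h => cases h <;> simp
  | refl a => rfl
  | symm a b _ ih => exact ih.symm
  | trans a b c _ _ ih ih' => exact ih.trans ih'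

/-! ### Word calculus -/

/-- The words `p` and `q` may replace each other inside any word, up to `≡`. -/
def FactorEquiv (p q : List ℤ) : Prop := ∀ u v : List ℤ, iwEquiv (u ++ p ++ v) (u ++ q ++ v)

/-- The word `w` is `≡`-equivalent to a word with two equal adjacent letters. -/
def HasRepeat (w : List ℤ) : Prop :=
  ∃ b, iwEquiv w b ∧ ∃ (u v : List ℤ) (x : ℤ), b = u ++ [x, x] ++ v

lemma iwEquiv.refl (a : List ℤ) : iwEquiv a a := Relation.EqvGen.refl a

lemma iwEquiv.symm {a b : List ℤ} (h : iwEquiv a b) : iwEquiv b a :=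
  Relation.EqvGen.symm _ _ h

lemma iwEquiv.trans {a b c : List ℤ} (h : iwEquiv a b) (h' : iwEquiv b c) : iwEquiv a c :=
  Relation.EqvGen.trans _ _ _ h h'

lemma iwEquiv.append_right {a b : List ℤ} (h : iwEquiv a b) (s : List ℤ) :
    iwEquiv (a ++ s) (b ++ s) := by
  induction h with
  | rel a b h =>
    refine Relation.EqvGen.rel _ _ ?_
    cases h with
    | braid u v x => simpa using IWStep.braid u (v ++ s) x
    | comm u v x y h => simpa using IWStep.comm u (v ++ s) x y h
    | init v x y => simpa using IWStep.init (v ++ s) x y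
  | refl a => exact .refl _
  | symm a b _ ih => exact iwEquiv.symm ih
  | trans a b c _ _ ih ih' => exact iwEquiv.trans ih ih'

lemma iwEquiv.hasRepeat {a b : List ℤ} (h : iwEquiv a b) (hb : HasRepeat b) : HasRepeat a := by
  obtain ⟨c, hc, h'⟩ := hb
  exact ⟨c, h.trans hc, h'⟩

lemma HasRepeat.append_right {a : List ℤ} (h : HasRepeat a) (s : List ℤ) :
    HasRepeat (a ++ s) := by
  obtain ⟨_, hc, u, v, x, rfl⟩ := h
  exact ⟨_, hc.append_right s, u, v ++ s, x, by simp⟩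

lemma hasRepeat_append (u v : List ℤ) (x : ℤ) : HasRepeat (u ++ [x, x] ++ v) :=
  ⟨_, .refl _, u, v, x, rfl⟩

namespace FactorEquiv

lemma refl (p : List ℤ) : FactorEquiv p p := fun _ _ => .refl _

lemma symm {p q : List ℤ} (h : FactorEquiv p q) : FactorEquiv q p :=
  fun u v => (h u v).symm

lemma trans {p q r : List ℤ} (h : FactorEquiv p q) (h' : FactorEquiv q r) : FactorEquiv p r :=
  fun u v => (h u v).trans (h' u v)

lemma iwEquiv {p q : List ℤ} (h : FactorEquiv p q) : iwEquiv p q := by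
  simpa using h [] []

lemma append_left {p q : List ℤ} (h : FactorEquiv p q) (s : List ℤ) :
    FactorEquiv (s ++ p) (s ++ q) := fun u v => by simpa using h (u ++ s) v

lemma append_right {p q : List ℤ} (h : FactorEquiv p q) (s : List ℤ) :
    FactorEquiv (p ++ s) (q ++ s) := fun u v => by simpa using h u (s ++ v)

lemma cons {p q : List ℤ} (h : FactorEquiv p q) (x : ℤ) : FactorEquiv (x :: p) (x :: q) :=
  h.append_left [x]

lemma swap {x y : ℤ} (h : 1 < |x - y|) (s : List ℤ) :
    FactorEquiv (x :: y :: s) (y :: x :: s) :=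
  append_right (p := [x, y]) (q := [y, x]) (fun u v => .rel _ _ (.comm u v x y h)) s

lemma braid (x : ℤ) (s : List ℤ) :
    FactorEquiv (x :: (x - 1) :: x :: s) ((x - 1) :: x :: (x - 1) :: s) := by
  have h : FactorEquiv [x - 1, x - 1 + 1, x - 1] [x - 1 + 1, x - 1, x - 1 + 1] :=
    fun u v => .rel _ _ (.braid u v (x - 1))
  rw [sub_add_cancel] at h
  exact h.symm.append_right s

lemma cons_comm {x : ℤ} {w : List ℤ} (h : ∀ y ∈ w, 1 < |x - y|) :
    FactorEquiv (x :: w) (w ++ [x]) := by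
  induction w with
  | nil => exact refl _
  | cons y w ih =>
    exact (swap (h y (by simp)) w).trans ((ih fun z hz => h z (by simp [hz])).cons y)

lemma append_comm {u v : List ℤ} (h : ∀ x ∈ u, ∀ y ∈ v, 1 < |x - y|) :
    FactorEquiv (u ++ v) (v ++ u) := by
  induction u with
  | nil => simpa using refl v
  | cons x u ih =>
    refine ((ih fun z hz => h z (by simp [hz])).cons x).trans ?_
    simpa using (cons_comm (h x (by simp))).append_right u

end FactorEquiv

/-- The descending word `N, N - 1, …` with `k` letters. -/
def descWord (N : ℤ) : ℕ → List ℤ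
  | 0 => []
  | k + 1 => N :: descWord (N - 1) k

lemma mem_descWord {N x : ℤ} {k : ℕ} : x ∈ descWord N k ↔ N - k < x ∧ x ≤ N := by
  induction k generalizing N with
  | zero => simp [descWord]
  | succ k ih =>
    simp only [descWord, List.mem_cons, ih]
    push_cast
    omega

lemma descWord_add (N : ℤ) (j k : ℕ) :
    descWord N (j + k) = descWord N j ++ descWord (N - j) k := by
  induction j generalizing N with
  | zero => simp [descWord]
  | succ j ih =>
    rw [Nat.add_right_comm]
    simp only [descWord, ih, List.cons_append]
    push_cast
    rw [sub_sub, add_comm (1 : ℤ)]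

lemma descWord_succ (N : ℤ) (k : ℕ) : descWord N (k + 1) = descWord N k ++ [N - k] := by
  rw [descWord_add]
  rfl

/-- A letter moves to the left past a descending word, dropping by one. -/
lemma FactorEquiv.descWord_slide {N i : ℤ} {k : ℕ} (h : N - k + 1 < i) (h' : i ≤ N) :
    FactorEquiv (descWord N k ++ [i]) ((i - 1) :: descWord N k) := by
  induction k generalizing N with
  | zero => simp at h; omega
  | succ k ih =>
    push_cast at h
    rcases h'.lt_or_eq with hi | rfl
    · exact ((ih (by omega) (by omega)).cons N).trans
        (swap (lt_abs.2 (Or.inl (by omega))) _)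
    · obtain _ | k := k
      · simp at h
      · have hc : FactorEquiv (descWord (i - 1 - 1) k ++ [i]) (i :: descWord (i - 1 - 1) k) :=
          (cons_comm fun y hy => lt_abs.2 (Or.inl (by
            have := mem_descWord.1 hy; omega))).symm
        exact ((hc.cons (i - 1)).cons i).trans (braid i _)

lemma FactorEquiv.descWord_slide_word {N : ℤ} {k : ℕ} {w : List ℤ}
    (h : ∀ i ∈ w, N - k + 1 < i ∧ i ≤ N) :
    FactorEquiv (descWord N k ++ w) (w.map (· - 1) ++ descWord N k) := by
  induction w with
  | nil => simpa using refl _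
  | cons i w ih =>
    have h1 := (descWord_slide (h i (by simp)).1 (h i (by simp)).2).append_right w
    have h2 := (ih fun j hj => h j (by simp [hj])).cons (i - 1)
    simpa using trans (by simpa using h1) h2

lemma hasRepeat_descWord_descWord (u : List ℤ) (N : ℤ) {j k : ℕ} (hk : 0 < k) (h : k ≤ j) :
    HasRepeat (u ++ descWord N k ++ descWord N j) := by
  obtain ⟨k, rfl⟩ := Nat.exists_eq_add_one_of_ne_zero hk.ne'
  obtain ⟨m, rfl⟩ := Nat.exists_eq_add_of_le h
  have h1 : FactorEquiv (descWord N (k + 1) ++ descWord N k)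
      ((descWord N k).map (· - 1) ++ descWord N (k + 1)) :=
    FactorEquiv.descWord_slide_word fun i hi => by
      have := mem_descWord.1 hi
      push_cast
      omega
  have h2 : descWord N (k + 1 + m) = descWord N k ++ ((N - k) :: descWord (N - k - 1) m) := by
    rw [add_assoc, add_comm 1 m, descWord_add]
    rfl
  have h3 := h1 u ((N - k) :: descWord (N - k - 1) m)
  rw [h2]
  refine iwEquiv.hasRepeat (by simpa using h3) ?_
  generalize (descWord N k).map (· - 1) = w
  rw [descWord_succ]
  simpa using hasRepeat_append (u ++ w ++ descWord N k) (descWord (N - k - 1) m) (N - k)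

/-! ### Normal forms -/

/-- All letters of `w` lie in the interval `(L, N]`. -/
def LettersIn (L N : ℤ) (w : List ℤ) : Prop := ∀ x ∈ w, L < x ∧ x ≤ N

/-- `w` is equivalent to a word in the letters `(L, N - 1]`, or to a word in the letters
`(L, N - 2]` followed by a descending word from `N`. -/
def Splits (L N : ℤ) (w : List ℤ) : Prop :=
  (∃ u, LettersIn L (N - 1) u ∧ iwEquiv w u) ∨
    ∃ (u : List ℤ) (k : ℕ), LettersIn L (N - 2) u ∧ L ≤ N - (k + 1) ∧
      iwEquiv w (u ++ descWord N (k + 1))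

lemma splits_of_iwEquiv {L N : ℤ} {a b : List ℤ} (h : iwEquiv a b)
    (hb : HasRepeat b ∨ Splits L N b) :
    HasRepeat a ∨ Splits L N a := by
  rcases hb with hb | ⟨u, hu, h'⟩ | ⟨u, k, hu, hk, h'⟩
  · exact .inl (h.hasRepeat hb)
  · exact .inr (.inl ⟨u, hu, h.trans h'⟩)
  · exact .inr (.inr ⟨u, k, hu, hk, h.trans h'⟩)

lemma one_lt_abs_of_lt {x y : ℤ} (h : x + 1 < y) : 1 < |x - y| := lt_abs.2 (.inr (by omega))

lemma one_lt_abs_of_gt {x y : ℤ} (h : y + 1 < x) : 1 < |x - y| := lt_abs.2 (.inl (by omega))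

/-- Appending the letter `N` to a word in smaller letters. -/
lemma splits_concat_top {L N : ℤ} {u : List ℤ} (hN : L < N)
    (hu : HasRepeat u ∨ Splits L (N - 1) u) :
    HasRepeat (u ++ [N]) ∨ Splits L N (u ++ [N]) := by
  rcases hu with hu | ⟨u', hu', h⟩ | ⟨u', k, hu', hk, h⟩
  · exact .inl (hu.append_right _)
  · exact .inr (.inr ⟨u', 0, fun x hx => by have := hu' x hx; omega, by simp; omega,
      h.append_right _⟩)
  · refine .inr (.inr ⟨u', k + 1, fun x hx => by have := hu' x hx; omega, by push_cast; omega,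
      (h.append_right [N]).trans ?_⟩)
    set D := descWord (N - 1 - 1) k with hD
    have hDN : ∀ y ∈ D, 1 < |N - y| := fun y hy => one_lt_abs_of_gt (by
      have := (mem_descWord.1 hy).2; omega)
    have c1 : FactorEquiv (D ++ [N]) (N :: D) := (FactorEquiv.cons_comm hDN).symm
    have c2 : FactorEquiv (u' ++ [N - 1, N]) ([N - 1, N] ++ u') :=
      FactorEquiv.append_comm fun x hx y hy => one_lt_abs_of_lt (by
        have := (hu' x hx).2
        simp at hy
        omega)
    have c3 : FactorEquiv (u' ++ [N, N - 1]) ([N, N - 1] ++ u') :=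
      FactorEquiv.append_comm fun x hx y hy => one_lt_abs_of_lt (by
        have := (hu' x hx).2
        simp at hy
        omega)
    have e1 := c1 (u' ++ [N - 1]) []
    have e2 := c2 [] D
    have e3 : iwEquiv ([N - 1, N] ++ (u' ++ D)) ([N, N - 1] ++ (u' ++ D)) :=
      .rel _ _ (.init _ _ _)
    have e4 := c3.symm [] D
    simp only [descWord, ← hD, List.append_assoc, List.nil_append, List.cons_append,
      List.append_nil] at e1 e2 e3 e4 ⊢
    exact (e1.trans e2).trans (e3.trans e4)

/-- Appending the letter `N` to a word in letters at most `N - 2` followed by a descending word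
from `N` with at least two letters. -/
lemma splits_concat_descWord_top {L N : ℤ} {u : List ℤ} {j : ℕ} (hj : L ≤ N - (j + 2))
    (hu : HasRepeat u ∨ Splits L (N - 2) u) :
    HasRepeat (u ++ descWord N (j + 2) ++ [N]) ∨ Splits L N (u ++ descWord N (j + 2) ++ [N]) := by
  rcases hu with hu | hu
  · exact .inl (by simpa using hu.append_right (descWord N (j + 2) ++ [N]))
  have e0 : FactorEquiv (descWord N (j + 2) ++ [N]) ([N, N - 1, N] ++ descWord (N - 2) j) := by
    have : FactorEquiv (descWord (N - 2) j ++ [N]) (N :: descWord (N - 2) j) :=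
      (FactorEquiv.cons_comm fun y hy => one_lt_abs_of_gt (by
        have := (mem_descWord.1 hy).2; omega)).symm
    have h2 : N - 1 - 1 = N - 2 := by ring
    simpa [descWord, h2] using (this.cons (N - 1)).cons N
  have e0' := e0.append_left u
  rw [← List.append_assoc] at e0'
  refine splits_of_iwEquiv e0'.iwEquiv ?_
  rcases hu with ⟨u', hu', h⟩ | ⟨u', p, hu', hp, h⟩
  · left
    refine (h.append_right _).hasRepeat ?_
    have c1 : FactorEquiv (u' ++ [N, N - 1, N]) ([N, N - 1, N] ++ u') :=
      FactorEquiv.append_comm fun x hx y hy => one_lt_abs_of_lt (by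
        have := (hu' x hx).2
        simp at hy
        omega)
    have e1 := (c1.append_right (descWord (N - 2) j)).iwEquiv
    have e2 : iwEquiv ([N, N - 1] ++ (N :: u' ++ descWord (N - 2) j))
      ([N - 1, N] ++ (N :: u' ++ descWord (N - 2) j)) := .rel _ _ (.init _ _ _)
    simp only [List.append_assoc, List.cons_append, List.nil_append] at e1 e2 ⊢
    exact (e1.trans e2).hasRepeat (hasRepeat_append [N - 1] (u' ++ descWord (N - 2) j) N)
  · set D := descWord (N - 2) j with hD
    set E := descWord (N - 2 - 1) p with hE
    have hp1 : descWord (N - 2) (p + 1) = (N - 2) :: E := rfl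
    have key : iwEquiv (u ++ ([N, N - 1, N] ++ D))
        (u' ++ [N - 2, N, N - 1] ++ descWord (N - 2) (p + 1) ++ D) := by
      have c1 : FactorEquiv (E ++ [N, N - 1, N]) ([N, N - 1, N] ++ E) :=
        FactorEquiv.append_comm fun x hx y hy => one_lt_abs_of_lt (by
          have := (mem_descWord.1 hx).2
          simp at hy
          omega)
      have c2 : FactorEquiv (u' ++ [N - 2, N, N - 1, N]) ([N - 2, N, N - 1, N] ++ u') :=
        FactorEquiv.append_comm fun x hx y hy => one_lt_abs_of_lt (by
          have := (hu' x hx).2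
          simp at hy
          omega)
      have c3 : FactorEquiv (u' ++ [N - 2, N, N - 1, N - 2]) ([N - 2, N, N - 1, N - 2] ++ u') :=
        FactorEquiv.append_comm fun x hx y hy => one_lt_abs_of_lt (by
          have := (hu' x hx).2
          simp at hy
          omega)
      have hsw : 1 < |N - (N - 2)| := one_lt_abs_of_gt (by omega)
      have h21 : N - 2 = N - 1 - 1 := by ring
      have br : FactorEquiv [N, N - 1, N] [N - 1, N, N - 1] := FactorEquiv.braid N []
      have br' : FactorEquiv [N - 1, N - 2, N - 1] [N - 2, N - 1, N - 2] := by
        rw [h21]; exact FactorEquiv.braid (N - 1) []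
      have r1 := (h.append_right ([N, N - 1, N] ++ D))
      have r2 := c1 (u' ++ [N - 2]) D
      have r3 := c2 [] (E ++ D)
      have r4 := br [N - 2] (u' ++ E ++ D)
      have r5 : iwEquiv ([N - 2, N - 1] ++ (N :: (N - 1) :: (u' ++ E ++ D)))
        ([N - 1, N - 2] ++ (N :: (N - 1) :: (u' ++ E ++ D))) := .rel _ _ (.init _ _ _)
      have r6 := (FactorEquiv.swap hsw []).symm [N - 1] ((N - 1) :: (u' ++ E ++ D))
      have r7 : iwEquiv ([N - 1, N] ++ ((N - 2) :: (N - 1) :: (u' ++ E ++ D)))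
        ([N, N - 1] ++ ((N - 2) :: (N - 1) :: (u' ++ E ++ D))) := .rel _ _ (.init _ _ _)
      have r8 := br' [N] (u' ++ E ++ D)
      have r9 := (FactorEquiv.swap hsw []) [] ((N - 1) :: (N - 2) :: (u' ++ E ++ D))
      have r10 := c3.symm [] (E ++ D)
      rw [hp1]
      simp only [hp1, List.append_assoc, List.cons_append, List.nil_append] at *
      exact r1.trans <| r2.trans <| r3.trans <| r4.trans <|
        r5.trans <| r6.trans <| r7.trans <| r8.trans <|
        r9.trans r10
    refine splits_of_iwEquiv key ?_
    rcases le_or_gt (p + 1) j with hpj | hpj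
    · exact .inl (hasRepeat_descWord_descWord _ _ (Nat.succ_pos p) hpj)
    · right; right
      have s1 : FactorEquiv (descWord (N - 2) (p + 1) ++ D)
          (D.map (· - 1) ++ descWord (N - 2) (p + 1)) :=
        FactorEquiv.descWord_slide_word fun i hi => by
          have := mem_descWord.1 hi
          push_cast
          omega
      have s2 : FactorEquiv ([N, N - 1] ++ D.map (· - 1)) (D.map (· - 1) ++ [N, N - 1]) :=
        FactorEquiv.append_comm fun x hx y hy => one_lt_abs_of_gt (by
          obtain ⟨t, ht, rfl⟩ := List.mem_map.1 hy
          have := (mem_descWord.1 ht).2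
          simp at hx
          omega)
      refine ⟨u' ++ [N - 2] ++ D.map (· - 1), p + 2, fun x hx => ?_, by push_cast; omega, ?_⟩
      · simp only [List.mem_append, List.mem_singleton, List.mem_map] at hx
        rcases hx with (hx | rfl) | ⟨t, ht, rfl⟩
        · have := hu' x hx
          omega
        · omega
        · have := mem_descWord.1 ht
          omega
      · have t1 := s1 (u' ++ [N - 2, N, N - 1]) []
        have t2 := s2 (u' ++ [N - 2]) (descWord (N - 2) (p + 1))
        have hd : descWord N (p + 2 + 1) = N :: (N - 1) :: descWord (N - 2) (p + 1) := by
          have h2 : N - 1 - 1 = N - 2 := by ring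
          simp only [descWord, h2]
        rw [hd]
        simp only [List.append_assoc, List.cons_append, List.nil_append, List.append_nil] at *
        exact t1.trans t2

lemma hasRepeat_or_splits {L : ℤ} (n : ℕ) {N : ℤ} (hN : N ≤ L + n) {w : List ℤ}
    (hw : LettersIn L N w) : HasRepeat w ∨ Splits L N w := by
  induction n using Nat.strong_induction_on generalizing N w with
  | _ n IH =>
  have IH' : ∀ M < N, ∀ u, LettersIn L M u → HasRepeat u ∨ Splits L M u := by
    intro M hM u hu
    obtain _ | n := n
    · refine .inr (.inl ⟨u, fun x hx => ?_, .refl _⟩)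
      have := hu x hx
      simp at hN
      omega
    · exact IH n n.lt_succ_self (by push_cast at hN; omega) hu
  induction w using List.reverseRecOn with
  | nil => exact .inr (.inl ⟨[], by simp [LettersIn], .refl _⟩)
  | append_singleton w i ih =>
    have hi := hw i (by simp)
    rcases ih fun x hx => hw x (by simp [hx]) with h | ⟨u, hu, h⟩ | ⟨u, k, hu, hk, h⟩
    · exact .inl (h.append_right _)
    · refine splits_of_iwEquiv (h.append_right [i]) ?_
      rcases hi.2.lt_or_eq with hiN | rfl
      · refine .inr (.inl ⟨_, fun x hx => ?_, .refl _⟩)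
        rcases List.mem_append.1 hx with hx | hx
        · exact hu x hx
        · rw [List.mem_singleton] at hx
          omega
      · exact splits_concat_top hi.1 (IH' _ (by omega) _ hu)
    · refine splits_of_iwEquiv (h.append_right [i]) ?_
      rcases lt_trichotomy i (N - (k + 1)) with h1 | rfl | h1
      · have c : FactorEquiv (descWord N (k + 1) ++ [i]) (i :: descWord N (k + 1)) :=
          (FactorEquiv.cons_comm fun y hy => one_lt_abs_of_lt (by
            have := (mem_descWord.1 hy).1
            push_cast at this
            omega)).symm
        refine .inr (.inr ⟨u ++ [i], k, fun x hx => ?_, hk, by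
          simpa using (c.append_left u).iwEquiv⟩)
        rcases List.mem_append.1 hx with hx | hx
        · exact hu x hx
        · rw [List.mem_singleton] at hx
          omega
      · refine .inr (.inr ⟨u, k + 1, hu, by push_cast; omega, ?_⟩)
        rw [descWord_succ N (k + 1)]
        push_cast
        simpa using iwEquiv.refl _
      · by_cases h2 : i = N - k
        · left
          rw [descWord_succ, h2]
          simpa using hasRepeat_append (u ++ descWord N k) [] (N - k)
        by_cases h3 : i = N
        · subst h3
          obtain _ | j := k
          · simp at h2
          · exact splits_concat_descWord_top (by push_cast at hk; omega) (IH' _ (by omega) _ hu)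
        · have c : FactorEquiv (descWord N (k + 1) ++ [i]) ((i - 1) :: descWord N (k + 1)) :=
            FactorEquiv.descWord_slide (by push_cast; omega) hi.2
          refine .inr (.inr ⟨u ++ [i - 1], k, fun x hx => ?_, hk, by
            simpa using (c.append_left u).iwEquiv⟩)
          rcases List.mem_append.1 hx with hx | hx
          · exact hu x hx
          · rw [List.mem_singleton] at hx
            omega

/-- Concatenations of descending words whose first letters increase by at least two. -/
inductive NormalForm : List ℤ → Prop
  | nil : NormalForm []
  | append {u : List ℤ} {N : ℤ} (k : ℕ) (hu : NormalForm u) (h : ∀ x ∈ u, x ≤ N - 2) :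
      NormalForm (u ++ descWord N (k + 1))

lemma hasRepeat_or_normalForm {L : ℤ} (n : ℕ) {N : ℤ} (hN : N ≤ L + n) {w : List ℤ}
    (hw : LettersIn L N w) :
    HasRepeat w ∨ ∃ w', NormalForm w' ∧ LettersIn L N w' ∧ iwEquiv w w' := by
  induction n using Nat.strong_induction_on generalizing N w with
  | _ n IH =>
  obtain _ | n := n
  · cases w with
    | nil => exact .inr ⟨[], .nil, hw, .refl _⟩
    | cons x w =>
      have := hw x (by simp)
      simp at hN
      omega
  replace IH : ∀ M < N, ∀ u, LettersIn L M u →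
      HasRepeat u ∨ ∃ w', NormalForm w' ∧ LettersIn L M w' ∧ iwEquiv u w' :=
    fun M hM u hu => IH n n.lt_succ_self (by push_cast at hN; omega) hu
  rcases hasRepeat_or_splits _ hN hw with h | ⟨u, hu, h⟩ | ⟨u, k, hu, hk, h⟩
  · exact .inl h
  · rcases IH _ (by omega) u hu with h' | ⟨w', hw', hL, h'⟩
    · exact .inl (h.hasRepeat h')
    · exact .inr ⟨w', hw', fun x hx => by have := hL x hx; omega, h.trans h'⟩
  · rcases IH _ (by omega) u hu with h' | ⟨w', hw', hL, h'⟩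
    · exact .inl (h.hasRepeat (h'.append_right _))
    · refine .inr ⟨_, .append k hw' fun x hx => (hL x hx).2, fun x hx => ?_,
        h.trans (h'.append_right _)⟩
      rcases List.mem_append.1 hx with hx | hx
      · have := hL x hx
        omega
      · have := mem_descWord.1 hx
        push_cast at this
        omega

lemma exists_lettersIn (w : List ℤ) : ∃ (L : ℤ) (n : ℕ), LettersIn L (L + n) w := by
  refine ⟨-((w.map Int.natAbs).sum + 1 : ℕ), 2 * ((w.map Int.natAbs).sum + 1), fun x hx => ?_⟩
  have : x.natAbs ≤ (w.map Int.natAbs).sum :=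
    List.single_le_sum (by simp) _ (List.mem_map_of_mem hx)
  generalize (w.map Int.natAbs).sum = s at this ⊢
  push_cast
  omega

/-! ### Normal forms are determined by their involutions -/

/-- The product `s_N s_{N-1} ⋯` with `k` factors. -/
def descPerm (N : ℤ) : ℕ → Equiv.Perm ℤ
  | 0 => 1
  | k + 1 => descPerm N k * sPerm (N - k)

lemma invHecke_append_descWord {u : List ℤ} {N : ℤ} (h : ∀ x ∈ u, x ≤ N - 2) (k : ℕ) :
    invHecke (u ++ descWord N (k + 1)) =
        (descPerm (N - 1) k)⁻¹ * (invHecke u * sPerm N) * descPerm (N - 1) k ∧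
      invHecke (u ++ descWord N (k + 1)) (N + 1) = N - k := by
  induction k with
  | zero =>
    have h1 : invHecke u N = N := invHecke_apply_of_lt h (by omega)
    have h2 : invHecke u (N + 1) = N + 1 := invHecke_apply_of_lt h (by omega)
    have h3 : (invHecke u)⁻¹ N = N := by rw [invHecke_inv, h1]
    have h4 : (invHecke u)⁻¹ (N + 1) = N + 1 := by rw [invHecke_inv, h2]
    have h5 : demazureRight (invHecke u) N = invHecke u * sPerm N := by
      simp [demazureRight, h1, h2]
    have h6 : invHecke (u ++ descWord N (0 + 1)) = invHecke u * sPerm N := by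
      rw [descWord_succ, descWord, List.nil_append, Nat.cast_zero, sub_zero, invHecke_concat,
        demazureConj, h5, demazureLeft, if_neg]
      rw [mul_inv_rev, sPerm_inv, Equiv.Perm.mul_apply, Equiv.Perm.mul_apply, h3, h4]
      simp [sPerm_apply]
    rw [h6]
    simp [descPerm, sPerm_apply, h1]
  | succ k ih =>
    set w := u ++ descWord N (k + 1) with hw
    set z := invHecke w with hz
    set i := N - 1 - k with hi
    have hzz : ∀ x, z (z x) = x := fun x => by
      conv_lhs => rw [hz, ← invHecke_inv w]
      rw [invHecke_inv w]
      have := congrArg (fun f : Equiv.Perm ℤ => f x) (IZ_invHecke w).2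
      simpa using this
    have hzinv : z⁻¹ = z := invHecke_inv w
    have hgt : ∀ x, N + 1 < x → z x = x := fun x hx =>
      invHecke_apply_of_lt (fun y hy => by
        rcases List.mem_append.1 hy with hy | hy
        · have := h y hy; omega
        · exact (mem_descWord.1 hy).2) hx
    have htop : z (N + 1) = i + 1 := by rw [ih.2]; omega
    have htop' : z (i + 1) = N + 1 := by rw [← htop, hzz]
    have hlt : z i < N + 1 := by
      by_contra hc
      rcases (not_lt.1 hc).lt_or_eq with hc | hc
      · have := hgt _ hc
        rw [hzz] at this
        omega
      · have := hzz i
        rw [← hc, htop] at this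
        omega
    have hR : demazureRight z i = z * sPerm i := by
      rw [demazureRight, if_pos (by rw [htop']; exact hlt)]
    have hL : demazureLeft i (z * sPerm i) = sPerm i * (z * sPerm i) := by
      rw [demazureLeft, if_pos]
      rw [mul_inv_rev, sPerm_inv, hzinv, Equiv.Perm.mul_apply, Equiv.Perm.mul_apply, htop']
      simp only [sPerm_apply]
      split_ifs <;> omega
    have hz' : invHecke (u ++ descWord N (k + 1 + 1)) = sPerm i * (z * sPerm i) := by
      rw [descWord_succ, ← List.append_assoc, invHecke_concat, ← hL, ← hR]
      have : N - ((k + 1 : ℕ) : ℤ) = i := by push_cast; omega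
      rw [this, demazureConj]
    rw [hz']
    constructor
    · rw [ih.1]
      simp [descPerm, mul_inv_rev, sPerm_inv, mul_assoc, hi]
    · have : sPerm i (N + 1) = N + 1 := by rw [sPerm_apply]; split_ifs <;> omega
      rw [Equiv.Perm.mul_apply, Equiv.Perm.mul_apply, this, htop]
      simp [sPerm_apply]
      omega

lemma invHecke_append_descWord_apply_of_lt {u : List ℤ} {N x : ℤ} (h : ∀ x ∈ u, x ≤ N - 2)
    (k : ℕ) (hx : N + 1 < x) : invHecke (u ++ descWord N k) x = x :=
  invHecke_apply_of_lt (fun y hy => by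
    rcases List.mem_append.1 hy with hy | hy
    · have := h y hy; omega
    · exact (mem_descWord.1 hy).2) hx

lemma NormalForm.eq_of_invHecke_eq {v w : List ℤ} (hv : NormalForm v) (hw : NormalForm w)
    (h : invHecke v = invHecke w) : v = w := by
  induction hv generalizing w with
  | nil =>
    cases hw with
    | nil => rfl
    | @append u N k hu hN =>
      have := (invHecke_append_descWord hN k).2
      rw [← h, invHecke_nil, Equiv.Perm.one_apply] at this
      omega
  | @append u N k hu hN ih =>
    have h1 := invHecke_append_descWord hN k
    cases hw with
    | nil =>
      have := h1.2
      rw [h, invHecke_nil, Equiv.Perm.one_apply] at this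
      omega
    | @append u' M l hu' hM =>
      have h2 := invHecke_append_descWord hM l
      have hNM : N = M := by
        rcases lt_trichotomy N M with hlt | heq | hlt
        · have e1 := h2.2
          rw [← h, invHecke_append_descWord_apply_of_lt hN _ (by omega)] at e1
          omega
        · exact heq
        · have e1 := h1.2
          rw [h, invHecke_append_descWord_apply_of_lt hM _ (by omega)] at e1
          omega
      subst hNM
      have hkl : k = l := by
        have := h1.2
        rw [h, h2.2] at this
        omega
      subst hkl
      have e := h1.1.symm.trans (h.trans h2.1)
      rw [ih hu' (by simpa using e)]

/-! ### Involution words -/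

lemma not_hasRepeat_of_mem_Rinv {z : Equiv.Perm ℤ} {a : List ℤ} (h : a ∈ Rinv z) :
    ¬ HasRepeat a := by
  rintro ⟨_, hb, u, v, x, rfl⟩
  have h1 := h.2 (u ++ [x] ++ v) (by
    rw [← invHecke_repeat, ← invHecke_eq_of_iwEquiv hb, h.1])
  have h2 := length_eq_of_iwEquiv hb
  simp at h1 h2
  omega

lemma exists_normalForm {a : List ℤ} (h : ¬ HasRepeat a) :
    ∃ b, NormalForm b ∧ iwEquiv a b := by
  obtain ⟨L, n, hL⟩ := exists_lettersIn a
  obtain ⟨b, hb, -, hab⟩ := (hasRepeat_or_normalForm n le_rfl hL).resolve_left h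
  exact ⟨b, hb, hab⟩

lemma mem_Rinv_of_not_hasRepeat {a : List ℤ} (h : ¬ HasRepeat a) : a ∈ Rinv (invHecke a) := by
  refine ⟨rfl, fun b hb => ?_⟩
  obtain ⟨c, hc, hmin⟩ := WellFounded.has_min (measure (List.length (α := ℤ))).wf
    {c | invHecke c = invHecke a} ⟨a, rfl⟩
  have hc' : c ∈ Rinv (invHecke a) := ⟨hc, fun d hd => not_lt.1 (hmin d hd)⟩
  obtain ⟨a', ha', haa'⟩ := exists_normalForm h
  obtain ⟨c', hc₁, hcc'⟩ := exists_normalForm (not_hasRepeat_of_mem_Rinv hc')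
  have : a' = c' := ha'.eq_of_invHecke_eq hc₁ (by
    rw [← invHecke_eq_of_iwEquiv haa', ← invHecke_eq_of_iwEquiv hcc', hc'.1])
  rw [length_eq_of_iwEquiv haa', this, ← length_eq_of_iwEquiv hcc']
  exact hc'.2 b hb

/-- a word is an involution word for some element of `I_ℤ` if and only
if its `≡`-equivalence class contains no word with two equal adjacent letters. -/
theorem stmt1 (a : List ℤ) :
    (∃ z : Equiv.Perm ℤ, IZ z ∧ a ∈ Rinv z) ↔
      ∀ b : List ℤ, iwEquiv a b → ¬∃ (u v : List ℤ) (x : ℤ), b = u ++ [x, x] ++ v := by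
  constructor
  · rintro ⟨z, -, ha⟩ b hb h
    exact not_hasRepeat_of_mem_Rinv ha ⟨b, hb, h⟩
  · intro h
    exact ⟨invHecke a, IZ_invHecke a,
      mem_Rinv_of_not_hasRepeat fun ⟨b, hb, h'⟩ => h b hb h'⟩
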